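/- arXiv:0803.0441 — 5 statements merged into one kernel-verified Lean document; each statement's English description precedes it below -/
import Mathlib

section
/- For every positive integer n, the n-th minimal worst-case error of multivariate integration over the unit ball of C^∞([0,1]^d) tends to 1 as d → ∞; that is, lim_{d→∞} e(n, B_d) = 1, where e(n, B_d) = inf over all linear algorithms A_{n,d} using n function values of sup_{f ∈ B_d} |I_d(f) − A_{n,d}(f)|. -/
open MeasureTheory

/-- Partial derivative of `f : ℝ^d → ℝ` with respect to the `i`-th coordinate. -/
noncomputable def partialDeriv {d : ℕ} (i : Fin d) (f : (Fin d → ℝ) → ℝ) :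
    (Fin d → ℝ) → ℝ :=
  fun x => fderiv ℝ f x (Pi.single i 1)

/-- The multiindex derivative `D^α f` for a multiindex `α = (α_1, …, α_d)`. -/
noncomputable def multiDeriv {d : ℕ} (α : Fin d → ℕ) (f : (Fin d → ℝ) → ℝ) :
    (Fin d → ℝ) → ℝ :=
  (List.finRange d).foldr (fun i g => (partialDeriv i)^[α i] g) f

/-- The unit cube `[0,1]^d`. -/
def cube (d : ℕ) : Set (Fin d → ℝ) := Set.Icc 0 1

/-- The unit ball `B_d` of `C^∞([0,1]^d)`: infinitely differentiable functions all of whose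
partial derivatives (of every order, including the function itself) are bounded by 1 on the
unit cube. -/
def unitBall (d : ℕ) : Set ((Fin d → ℝ) → ℝ) :=
  {f | ContDiff ℝ (⊤ : ℕ∞) f ∧ ∀ (α : Fin d → ℕ), ∀ x ∈ cube d, |multiDeriv α f x| ≤ 1}

/-- Worst-case error of the linear algorithm `A(f) = ∑ j, a j * f (x j)` over `B_d`. -/
noncomputable def wcError {n d : ℕ} (a : Fin n → ℝ) (x : Fin n → Fin d → ℝ) : ℝ :=
  sSup ((fun f => |(∫ t in cube d, f t) - ∑ j, a j * f (x j)|) '' unitBall d)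

/-- The `n`-th minimal worst-case error `e(n, B_d)`: the infimum of the worst-case errors of
all linear algorithms using `n` function values at points of the cube. -/
noncomputable def minError (n d : ℕ) : ℝ :=
  sInf {E | ∃ (a : Fin n → ℝ) (x : Fin n → Fin d → ℝ), (∀ j, x j ∈ cube d) ∧ E = wcError a x}

lemma weier {ι : Type*} (s : Finset ι) (p : ι → ℝ) (h : ∀ j, 0 ≤ p j ∧ p j ≤ 1) :
    1 - ∑ j ∈ s, p j ≤ ∏ j ∈ s, (1 - p j) := by
  classical
  induction s using Finset.induction_on with
  | empty => simp
  | insert a s ha ih =>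
    rw [Finset.sum_insert ha, Finset.prod_insert ha]
    have h1 := h a
    have h2 : 0 ≤ ∑ j ∈ s, p j := Finset.sum_nonneg fun j _ => (h j).1
    have h3 := mul_le_mul_of_nonneg_left ih (sub_nonneg.2 h1.2)
    nlinarith [mul_nonneg h1.1 h2]

/-- One block of the fooling function and its derivatives. -/
noncomputable def blk {n d : ℕ} (b : Fin d → Fin n) (c : Fin d → ℝ) (m : Fin d → ℕ) (j : Fin n)
    (t : Fin d → ℝ) : ℝ :=
  (if ∀ i, b i = j → m i = 0 then (1 : ℝ) else 0) -
    ∏ i, if b i = j then Real.cos (t i - c i + m i * (Real.pi / 2)) else 1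

/-- The fooling function (`m = 0`) and its partial derivatives. -/
noncomputable def fool {n d : ℕ} (b : Fin d → Fin n) (c : Fin d → ℝ) (m : Fin d → ℕ)
    (t : Fin d → ℝ) : ℝ := ∏ j, blk b c m j t

lemma blk_contDiff {n d : ℕ} (b : Fin d → Fin n) (c : Fin d → ℝ) (m : Fin d → ℕ) (j : Fin n) :
    ContDiff ℝ (⊤ : ℕ∞) (blk b c m j) := by
  unfold blk
  refine contDiff_const.sub (contDiff_prod fun i _ => ?_)
  split_ifs
  · exact Real.contDiff_cos.comp (((contDiff_apply ℝ ℝ i).sub contDiff_const).add contDiff_const)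
  · exact contDiff_const

lemma fool_contDiff {n d : ℕ} (b : Fin d → Fin n) (c : Fin d → ℝ) (m : Fin d → ℕ) :
    ContDiff ℝ (⊤ : ℕ∞) (fool b c m) := by
  unfold fool
  exact contDiff_prod fun j _ => blk_contDiff b c m j

lemma blk_line_ne {n d : ℕ} (b : Fin d → Fin n) (c : Fin d → ℝ) (m : Fin d → ℕ) (j : Fin n)
    (t : Fin d → ℝ) (i : Fin d) (h : b i ≠ j) (s : ℝ) :
    blk b c m j (t + s • Pi.single i 1) = blk b c m j t := by
  unfold blk
  congr 1
  refine Finset.prod_congr rfl fun k _ => ?_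
  split_ifs with hk
  · have : k ≠ i := by rintro rfl; exact h hk
    simp [this]
  · rfl

lemma blk_succ_ne {n d : ℕ} (b : Fin d → Fin n) (c : Fin d → ℝ) (m : Fin d → ℕ) (j : Fin n)
    (t : Fin d → ℝ) (i : Fin d) (h : b i ≠ j) :
    blk b c (m + Pi.single i 1) j t = blk b c m j t := by
  have e : ∀ k, b k = j → (m + Pi.single i 1 : Fin d → ℕ) k = m k := by
    intro k hk
    have : k ≠ i := by rintro rfl; exact h hk
    simp [this]
  unfold blk
  congr 1
  · refine if_congr ?_ rfl rfl
    exact forall_congr' fun k => imp_congr_right fun hk => by rw [e k hk]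
  · refine Finset.prod_congr rfl fun k _ => ?_
    split_ifs with hk
    · rw [e k hk]
    · rfl

lemma blk_hasDeriv {n d : ℕ} (b : Fin d → Fin n) (c : Fin d → ℝ) (m : Fin d → ℕ)
    (t : Fin d → ℝ) (i : Fin d) :
    HasDerivAt (fun s : ℝ => blk b c m (b i) (t + s • Pi.single i 1))
      (blk b c (m + Pi.single i 1) (b i) t) 0 := by
  set R : ℝ := ∏ k ∈ Finset.univ.erase i,
    if b k = b i then Real.cos (t k - c k + m k * (Real.pi / 2)) else 1 with hR
  have h1 : (fun s : ℝ => blk b c m (b i) (t + s • Pi.single i 1)) = fun s =>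
      (if ∀ k, b k = b i → m k = 0 then (1 : ℝ) else 0) -
        Real.cos (s + (t i - c i + m i * (Real.pi / 2))) * R := by
    funext s
    unfold blk
    rw [← Finset.mul_prod_erase _ _ (Finset.mem_univ i)]
    congr 2
    · simp; congr 1; ring
    · refine Finset.prod_congr rfl fun k hk => ?_
      have : k ≠ i := (Finset.mem_erase.1 hk).1
      simp [this]
  have h2 : blk b c (m + Pi.single i 1) (b i) t =
      - (- Real.sin (0 + (t i - c i + m i * (Real.pi / 2))) * R) := by
    unfold blk
    rw [← Finset.mul_prod_erase _ _ (Finset.mem_univ i)]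
    rw [if_neg]
    · have e1 : Real.cos (t i - c i + ((m + Pi.single i 1 : Fin d → ℕ) i : ℕ) * (Real.pi / 2)) =
          - Real.sin (0 + (t i - c i + m i * (Real.pi / 2))) := by
        rw [← Real.cos_add_pi_div_two]
        simp; congr 1; ring
      have e2 : (∏ k ∈ Finset.univ.erase i, if b k = b i then
          Real.cos (t k - c k + ((m + Pi.single i 1 : Fin d → ℕ) k : ℕ) * (Real.pi / 2)) else 1) = R := by
        refine Finset.prod_congr rfl fun k hk => ?_
        have : k ≠ i := (Finset.mem_erase.1 hk).1
        simp [this]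
      rw [e2, if_pos rfl, e1]; ring
    · intro h
      have := h i rfl
      simp at this
  rw [h1, h2]
  have h3 : HasDerivAt (fun s : ℝ => Real.cos (s + (t i - c i + m i * (Real.pi / 2))))
      (- Real.sin (0 + (t i - c i + m i * (Real.pi / 2)))) 0 := by
    simpa using (Real.hasDerivAt_cos (0 + (t i - c i + m i * (Real.pi / 2)))).comp_add_const 0 _
  exact (h3.mul_const R).const_sub _

lemma partialDeriv_fool {n d : ℕ} (b : Fin d → Fin n) (c : Fin d → ℝ) (m : Fin d → ℕ)
    (i : Fin d) : partialDeriv i (fool b c m) = fool b c (m + Pi.single i 1) := by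
  funext t
  unfold partialDeriv
  have hd : DifferentiableAt ℝ (fool b c m) t :=
    ((fool_contDiff b c m).differentiable (by simp)) t
  rw [← hd.lineDeriv_eq_fderiv]
  refine HasLineDerivAt.lineDeriv ?_
  unfold HasLineDerivAt
  have h1 : (fun s : ℝ => fool b c m (t + s • Pi.single i 1)) = fun s =>
      blk b c m (b i) (t + s • Pi.single i 1) * ∏ j ∈ Finset.univ.erase (b i), blk b c m j t := by
    funext s
    unfold fool
    rw [← Finset.mul_prod_erase _ _ (Finset.mem_univ (b i))]
    congr 1
    refine Finset.prod_congr rfl fun k hk => ?_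
    exact blk_line_ne b c m k t i (Finset.mem_erase.1 hk).1.symm s
  have h2 : fool b c (m + Pi.single i 1) t = blk b c (m + Pi.single i 1) (b i) t *
      ∏ j ∈ Finset.univ.erase (b i), blk b c m j t := by
    unfold fool
    rw [← Finset.mul_prod_erase _ _ (Finset.mem_univ (b i))]
    congr 1
    refine Finset.prod_congr rfl fun k hk => ?_
    exact blk_succ_ne b c m k t i (Finset.mem_erase.1 hk).1.symm
  rw [h1, h2]
  exact (blk_hasDeriv b c m t i).mul_const _

lemma multiDeriv_fool {n d : ℕ} (b : Fin d → Fin n) (c : Fin d → ℝ) (α : Fin d → ℕ) :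
    ∃ m, multiDeriv α (fool b c 0) = fool b c m := by
  unfold multiDeriv
  induction List.finRange d with
  | nil => exact ⟨0, rfl⟩
  | cons i l ih =>
    rw [List.foldr_cons]
    generalize α i = k
    induction k with
    | zero => simpa using ih
    | succ k ihk =>
      obtain ⟨m, hm⟩ := ihk
      rw [Function.iterate_succ_apply', hm]
      exact ⟨_, partialDeriv_fool b c m i⟩

lemma cube_cos {d : ℕ} {t c : Fin d → ℝ} (ht : t ∈ cube d) (hc : c ∈ cube d) (i : Fin d) :
    0 ≤ Real.cos (t i - c i) := by
  have h1 := ht.1 i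
  have h2 := ht.2 i
  have h3 := hc.1 i
  have h4 := hc.2 i
  simp at h1 h2 h3 h4
  have := Real.pi_gt_three
  apply Real.cos_nonneg_of_neg_pi_div_two_le_of_le <;> linarith

/-- The product of cosines over a block. -/
noncomputable def cosBlk {n d : ℕ} (b : Fin d → Fin n) (c : Fin d → ℝ) (j : Fin n)
    (t : Fin d → ℝ) : ℝ := ∏ i, if b i = j then Real.cos (t i - c i) else 1

lemma cosBlk_mem {n d : ℕ} (b : Fin d → Fin n) {t c : Fin d → ℝ} (ht : t ∈ cube d)
    (hc : c ∈ cube d) (j : Fin n) : 0 ≤ cosBlk b c j t ∧ cosBlk b c j t ≤ 1 := by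
  unfold cosBlk
  constructor
  · refine Finset.prod_nonneg fun i _ => ?_
    split_ifs
    · exact cube_cos ht hc i
    · exact zero_le_one
  · refine Finset.prod_le_one (fun i _ => ?_) fun i _ => ?_
    · split_ifs
      · exact cube_cos ht hc i
      · exact zero_le_one
    · split_ifs
      · exact Real.cos_le_one _
      · exact le_rfl

lemma fool_zero {n d : ℕ} (b : Fin d → Fin n) (c t : Fin d → ℝ) :
    fool b c 0 t = ∏ j, (1 - cosBlk b c j t) := by
  simp [fool, blk, cosBlk]

lemma abs_fool_le {n d : ℕ} (b : Fin d → Fin n) {t c : Fin d → ℝ} (ht : t ∈ cube d)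
    (hc : c ∈ cube d) (m : Fin d → ℕ) : |fool b c m t| ≤ 1 := by
  unfold fool
  rw [Finset.abs_prod]
  refine Finset.prod_le_one (fun _ _ => abs_nonneg _) fun j _ => ?_
  unfold blk
  split_ifs with h
  · have e : (∏ i, if b i = j then Real.cos (t i - c i + m i * (Real.pi / 2)) else 1) =
        cosBlk b c j t := by
      unfold cosBlk
      refine Finset.prod_congr rfl fun i _ => ?_
      split_ifs with hi
      · simp [h i hi]
      · rfl
    rw [e]
    have := cosBlk_mem b ht hc j
    rw [abs_le]; constructor <;> linarith
  · rw [zero_sub, abs_neg, Finset.abs_prod]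
    refine Finset.prod_le_one (fun _ _ => abs_nonneg _) fun i _ => ?_
    split_ifs
    · exact Real.abs_cos_le_one _
    · simp

lemma fool_mem {n d : ℕ} (b : Fin d → Fin n) {c : Fin d → ℝ} (hc : c ∈ cube d) :
    fool b c 0 ∈ unitBall d := by
  refine ⟨fool_contDiff b c 0, fun α x hx => ?_⟩
  obtain ⟨m, hm⟩ := multiDeriv_fool b c α
  rw [hm]
  exact abs_fool_le b hx hc m

lemma cube_restrict (d : ℕ) : (volume : Measure (Fin d → ℝ)).restrict (cube d) =
    Measure.pi fun _ : Fin d => (volume : Measure ℝ).restrict (Set.Icc 0 1) := by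
  rw [cube, ← Set.pi_univ_Icc, volume_pi, Measure.restrict_pi_pi]
  rfl

lemma cube_prob (d : ℕ) :
    IsProbabilityMeasure ((volume : Measure (Fin d → ℝ)).restrict (cube d)) := by
  rw [cube_restrict]
  have : IsProbabilityMeasure ((volume : Measure ℝ).restrict (Set.Icc 0 1)) := ⟨by simp⟩
  infer_instance

lemma int_cos (c : ℝ) :
    ∫ t in Set.Icc (0 : ℝ) 1, Real.cos (t - c) ≤ 2 * Real.sin (1 / 2) := by
  rw [integral_Icc_eq_integral_Ioc, ← intervalIntegral.integral_of_le zero_le_one,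
    intervalIntegral.integral_comp_sub_right (fun t => Real.cos t), integral_cos]
  rw [Real.sin_sub_sin]
  have e1 : (1 - c - (0 - c)) / 2 = 1 / 2 := by ring
  rw [e1]
  have h0 : 0 ≤ Real.sin (1 / 2) := (Real.sin_pos_of_pos_of_le_one (by norm_num) (by norm_num)).le
  have := Real.cos_le_one ((1 - c + (0 - c)) / 2)
  nlinarith

lemma int_cos_nonneg {c : ℝ} (h0 : 0 ≤ c) (h1 : c ≤ 1) :
    0 ≤ ∫ t in Set.Icc (0 : ℝ) 1, Real.cos (t - c) := by
  refine setIntegral_nonneg measurableSet_Icc fun t ht => ?_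
  have := Real.pi_gt_three
  apply Real.cos_nonneg_of_neg_pi_div_two_le_of_le <;> linarith [ht.1, ht.2]

lemma int_cosBlk {n d : ℕ} (b : Fin d → Fin n) {c : Fin d → ℝ} (hc : c ∈ cube d) (j : Fin n) :
    ∫ t in cube d, cosBlk b c j t ≤
      (2 * Real.sin (1 / 2)) ^ (Finset.univ.filter fun i => b i = j).card := by
  unfold cosBlk
  rw [cube_restrict, integral_fintype_prod_eq_prod
    (f := fun i (s : ℝ) => if b i = j then Real.cos (s - c i) else 1)]
  rw [← Finset.prod_const, Finset.prod_filter]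
  refine Finset.prod_le_prod (fun i _ => ?_) fun i _ => ?_
  · split_ifs
    · exact int_cos_nonneg (hc.1 i) (hc.2 i)
    · simp
  · split_ifs
    · exact int_cos _
    · simp

lemma cosBlk_cont {n d : ℕ} (b : Fin d → Fin n) (c : Fin d → ℝ) (j : Fin n) :
    Continuous (cosBlk b c j) := by
  unfold cosBlk
  refine continuous_finsetProd _ fun i _ => ?_
  split_ifs <;> fun_prop

lemma int_fool {n d : ℕ} (b : Fin d → Fin n) {c : Fin d → ℝ} (hc : c ∈ cube d) (N : ℕ)
    (hN : ∀ j, N ≤ (Finset.univ.filter fun i => b i = j).card) :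
    1 - n * (2 * Real.sin (1 / 2)) ^ N ≤ ∫ t in cube d, fool b c 0 t := by
  have := cube_prob d
  have hcomp : IsCompact (cube d) := isCompact_Icc
  have hint : ∀ j, IntegrableOn (cosBlk b c j) (cube d) := fun j =>
    (cosBlk_cont b c j).continuousOn.integrableOn_compact hcomp
  have hq0 : 0 ≤ 2 * Real.sin (1 / 2) := by
    have := Real.sin_pos_of_pos_of_le_one (x := 1 / 2) (by norm_num) (by norm_num)
    linarith
  have hq1 : 2 * Real.sin (1 / 2) ≤ 1 := by
    have := Real.sin_lt (x := 1 / 2) (by norm_num)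
    linarith
  have h1 : ∫ t in cube d, (1 - ∑ j, cosBlk b c j t) = 1 - ∑ j, ∫ t in cube d, cosBlk b c j t := by
    rw [integral_sub (integrable_const _) (integrable_finsetSum _ fun j _ => hint j),
      integral_finsetSum _ fun j _ => hint j]
    simp
  calc 1 - n * (2 * Real.sin (1 / 2)) ^ N ≤ 1 - ∑ j, ∫ t in cube d, cosBlk b c j t := by
        have : ∑ j, ∫ t in cube d, cosBlk b c j t ≤ ∑ j : Fin n, (2 * Real.sin (1 / 2)) ^ N :=
          Finset.sum_le_sum fun j _ =>
            (int_cosBlk b hc j).trans (pow_le_pow_of_le_one hq0 hq1 (hN j))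
        simp at this ⊢
        linarith
    _ = ∫ t in cube d, (1 - ∑ j, cosBlk b c j t) := h1.symm
    _ ≤ _ := by
        refine setIntegral_mono_on ?_ ?_ measurableSet_Icc ?_
        · exact (integrable_const _).sub (integrable_finsetSum _ fun j _ => hint j)
        · exact (fool_contDiff b c 0).continuous.continuousOn.integrableOn_compact hcomp
        · intro t ht
          rw [fool_zero]
          exact weier Finset.univ _ fun j => cosBlk_mem b ht hc j

lemma unitBall_abs {d : ℕ} {f : (Fin d → ℝ) → ℝ} (hf : f ∈ unitBall d) {x : Fin d → ℝ}
    (hx : x ∈ cube d) : |f x| ≤ 1 := by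
  have h := hf.2 0 x hx
  have e : multiDeriv 0 f = f := by
    unfold multiDeriv
    induction List.finRange d with
    | nil => rfl
    | cons i l ih => rw [List.foldr_cons, ih]; rfl
  rwa [e] at h

lemma unitBall_int {d : ℕ} {f : (Fin d → ℝ) → ℝ} (hf : f ∈ unitBall d) :
    |∫ t in cube d, f t| ≤ 1 := by
  have := cube_prob d
  have h := norm_setIntegral_le_of_norm_le_const (μ := volume) (s := cube d) (f := f) (C := 1)
    (by rw [← Measure.restrict_apply_univ]; exact measure_lt_top _ _)
    (fun x hx => unitBall_abs hf hx)
  have e : volume.real (cube d) = 1 := by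
    rw [Measure.real, ← Measure.restrict_apply_univ, measure_univ]; rfl
  rw [e] at h
  simpa using h

lemma wc_bdd {n d : ℕ} (a : Fin n → ℝ) (x : Fin n → Fin d → ℝ) (hx : ∀ j, x j ∈ cube d) :
    BddAbove ((fun f => |(∫ t in cube d, f t) - ∑ j, a j * f (x j)|) '' unitBall d) := by
  refine ⟨1 + ∑ j, |a j|, ?_⟩
  rintro _ ⟨f, hf, rfl⟩
  refine (abs_sub _ _).trans (add_le_add (unitBall_int hf) ?_)
  refine (Finset.abs_sum_le_sum_abs _ _).trans (Finset.sum_le_sum fun j _ => ?_)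
  rw [abs_mul]
  exact mul_le_of_le_one_right (abs_nonneg _) (unitBall_abs hf (hx j))

lemma wc_nonneg {n d : ℕ} (a : Fin n → ℝ) (x : Fin n → Fin d → ℝ) : 0 ≤ wcError a x := by
  refine Real.sSup_nonneg ?_
  rintro _ ⟨f, _, rfl⟩
  exact abs_nonneg _

lemma minError_le (n d : ℕ) : minError n d ≤ 1 := by
  have h : wcError (0 : Fin n → ℝ) (0 : Fin n → Fin d → ℝ) ≤ 1 := by
    refine Real.sSup_le ?_ zero_le_one
    rintro _ ⟨f, hf, rfl⟩
    simpa using unitBall_int hf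
  refine le_trans (csInf_le ⟨0, ?_⟩ ⟨0, 0, fun j => ⟨le_rfl, zero_le_one⟩, rfl⟩) h
  rintro _ ⟨a, x, _, rfl⟩
  exact wc_nonneg a x

lemma le_minError (n d : ℕ) (hn : 0 < n) :
    1 - n * (2 * Real.sin (1 / 2)) ^ (d / n) ≤ minError n d := by
  refine le_csInf ⟨_, 0, 0, fun j => ⟨le_rfl, zero_le_one⟩, rfl⟩ ?_
  rintro _ ⟨a, x, hx, rfl⟩
  let b : Fin d → Fin n := fun i => ⟨i % n, Nat.mod_lt _ hn⟩
  let c : Fin d → ℝ := fun i => x (b i) i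
  have hc : c ∈ cube d := ⟨fun i => (hx (b i)).1 i, fun i => (hx (b i)).2 i⟩
  have hz : ∀ j, fool b c 0 (x j) = 0 := by
    intro j
    rw [fool_zero]
    refine Finset.prod_eq_zero (Finset.mem_univ j) ?_
    have : cosBlk b c j (x j) = 1 := by
      unfold cosBlk
      refine Finset.prod_eq_one fun i _ => ?_
      split_ifs with h
      · simp [c, h]
      · rfl
    rw [this, sub_self]
  have hN : ∀ j, d / n ≤ (Finset.univ.filter fun i => b i = j).card := by
    intro j
    have hlt : ∀ k : Fin (d / n), (k : ℕ) * n + j < d := by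
      intro k
      have h1 : ((k : ℕ) + 1) * n ≤ d / n * n := Nat.mul_le_mul_right n k.2
      have h2 := Nat.div_mul_le_self d n
      have h3 := j.2
      rw [add_mul] at h1
      omega
    have := Finset.card_le_card_of_injOn (s := (Finset.univ : Finset (Fin (d / n))))
      (t := Finset.univ.filter fun i => b i = j) (fun k => ⟨(k : ℕ) * n + j, hlt k⟩)
      (by
        intro k _
        simp [b, Fin.ext_iff, Nat.add_mod, Nat.mod_eq_of_lt j.2])
      (by
        intro k _ l _ h
        simp at h
        rcases h with h | h
        · exact Fin.ext h
        · omega)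
    simpa using this
  refine (int_fool b hc _ hN).trans ?_
  refine le_trans (le_abs_self _) (le_csSup (wc_bdd a x hx) ⟨fool b c 0, fool_mem b hc, ?_⟩)
  simp [hz]

/-- For every positive integer `n`, the `n`-th minimal worst-case error of multivariate
integration over the unit ball of `C^∞([0,1]^d)` tends to `1` as `d → ∞`. -/
theorem minError_tendsto_one (n : ℕ) (hn : 0 < n) :
    Filter.Tendsto (fun d => minError n d) Filter.atTop (nhds 1) := by
  have hq0 : 0 ≤ 2 * Real.sin (1 / 2) := by
    have := Real.sin_pos_of_pos_of_le_one (x := 1 / 2) (by norm_num) (by norm_num)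
    linarith
  have hq1 : 2 * Real.sin (1 / 2) < 1 := by
    have := Real.sin_lt (x := 1 / 2) (by norm_num)
    linarith
  have h1 : Filter.Tendsto (fun d : ℕ => 1 - n * (2 * Real.sin (1 / 2)) ^ (d / n))
      Filter.atTop (nhds (1 - n * 0)) :=
    (((tendsto_pow_atTop_nhds_zero_of_lt_one hq0 hq1).comp
      (Nat.tendsto_div_const_atTop hn.ne')).const_mul _).const_sub _
  rw [mul_zero, sub_zero] at h1
  exact tendsto_of_tendsto_of_tendsto_of_le_of_le h1 tendsto_const_nhds
    (fun d => le_minError n d hn) (fun d => minError_le n d)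
end

section
/- For every positive integer n and every η ∈ (0,1) there exists a positive integer D such that for all d ≥ D the following holds: for every choice of real coefficients a_1,…,a_n and sample points x_1,…,x_n ∈ [0,1]^d, there exists an infinitely differentiable function f : [0,1]^d → ℝ with |D^α f(x)| ≤ 1 for every multiindex α and every x ∈ [0,1]^d, such that f(x_j) = 0 for all j = 1,…,n and ∫_{[0,1]^d} f(t) dt > 1 − η. In particular |I_d(f) − Σ_j a_j f(x_j)| > 1 − η. -/
open MeasureTheory

open scoped ContDiff

/-- Smooth functions on the line whose `k`-th derivative is bounded by `c ^ k`. -/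
def BernsteinClass (c : ℝ) (g : ℝ → ℝ) : Prop :=
  ContDiff ℝ ∞ g ∧ ∀ (k : ℕ) (s : ℝ), |iteratedDeriv k g s| ≤ c ^ k

lemma BernsteinClass.mul {c c' : ℝ} {g h : ℝ → ℝ} (hg : BernsteinClass c g)
    (hh : BernsteinClass c' h) : BernsteinClass (c + c') (g * h) := by
  refine ⟨hg.1.mul hh.1, fun k s => ?_⟩
  have h1 : ContDiffAt ℝ k g s := (hg.1.of_le (by exact_mod_cast le_top)).contDiffAt
  have h2 : ContDiffAt ℝ k h s := (hh.1.of_le (by exact_mod_cast le_top)).contDiffAt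
  rw [iteratedDeriv_mul h1 h2, add_pow]
  refine (Finset.abs_sum_le_sum_abs _ _).trans (Finset.sum_le_sum fun i _ => ?_)
  rw [abs_mul, abs_mul, Nat.abs_cast]
  have e1 := hg.2 i s
  have e2 := hh.2 (k - i) s
  have : |iteratedDeriv i g s| * |iteratedDeriv (k - i) h s| ≤ c ^ i * c' ^ (k - i) :=
    mul_le_mul e1 e2 (abs_nonneg _) ((abs_nonneg _).trans e1)
  have h3 : (0 : ℝ) ≤ (k.choose i : ℝ) := by positivity
  nlinarith

lemma BernsteinClass.one : BernsteinClass 0 1 := by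
  refine ⟨contDiff_const, fun k s => ?_⟩
  have : (1 : ℝ → ℝ) = fun _ => (1 : ℝ) := rfl
  rw [this, iteratedDeriv_const]
  rcases k with _ | k <;> simp

lemma BernsteinClass.prod {ι : Type*} (I : Finset ι) {c : ℝ} {g : ι → ℝ → ℝ}
    (hg : ∀ i, BernsteinClass c (g i)) :
    BernsteinClass (I.card * c) (∏ i ∈ I, g i) := by
  classical
  induction I using Finset.induction_on with
  | empty => simpa using BernsteinClass.one
  | insert i I hi ih =>
    rw [Finset.prod_insert hi, Finset.card_insert_of_notMem hi]
    have := (hg i).mul ih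
    convert this using 1
    push_cast; ring

/-- Frequencies of the Fejer kernel. -/
noncomputable def fejFreq (N : ℕ) (c : ℝ) (p : Fin N × Fin N) : ℝ :=
  (((p.1 : ℕ) : ℝ) - ((p.2 : ℕ) : ℝ)) / N * c

/-- The normalised Fejer kernel. -/
noncomputable def fejKer (N : ℕ) (c b s : ℝ) : ℝ :=
  ((N : ℝ) ^ 2)⁻¹ * ∑ p : Fin N × Fin N, Real.cos (fejFreq N c p * (s - b))

lemma abs_fejFreq_le {N : ℕ} {c : ℝ} (hc : 0 ≤ c) (p : Fin N × Fin N) :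
    |fejFreq N c p| ≤ c := by
  unfold fejFreq
  have h1 : ((p.1 : ℕ) : ℝ) ≤ N := by exact_mod_cast p.1.2.le
  have h2 : ((p.2 : ℕ) : ℝ) ≤ N := by exact_mod_cast p.2.2.le
  have h3 : (0 : ℝ) ≤ ((p.1 : ℕ) : ℝ) := by positivity
  have h4 : (0 : ℝ) ≤ ((p.2 : ℕ) : ℝ) := by positivity
  rw [abs_mul, abs_of_nonneg hc, abs_div, Nat.abs_cast]
  have : |((p.1 : ℕ) : ℝ) - ((p.2 : ℕ) : ℝ)| / N ≤ 1 := by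
    apply div_le_one_of_le₀ _ (by positivity)
    rw [abs_le]; constructor <;> linarith
  nlinarith

lemma fejKer_nonneg (N : ℕ) (c b s : ℝ) : 0 ≤ fejKer N c b s := by
  unfold fejKer
  have : ∑ p : Fin N × Fin N, Real.cos (fejFreq N c p * (s - b)) =
      (∑ k : Fin N, Real.cos (((k : ℕ) : ℝ) / N * c * (s - b))) ^ 2 +
      (∑ k : Fin N, Real.sin (((k : ℕ) : ℝ) / N * c * (s - b))) ^ 2 := by
    rw [sq, sq, Finset.sum_mul_sum, Finset.sum_mul_sum, ← Finset.sum_add_distrib,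
      Fintype.sum_prod_type]
    refine Finset.sum_congr rfl fun k _ => ?_
    rw [← Finset.sum_add_distrib]
    refine Finset.sum_congr rfl fun l _ => ?_
    rw [← Real.cos_sub]
    congr 1
    unfold fejFreq
    ring
  rw [this]
  positivity

lemma inv_mul_sum_le {N : ℕ} (hN : 0 < N) {u : Fin N × Fin N → ℝ} {B : ℝ} (h : ∀ p, u p ≤ B) :
    ((N : ℝ) ^ 2)⁻¹ * ∑ p, u p ≤ B := by
  have h1 : ∑ p, u p ≤ ∑ _p : Fin N × Fin N, B := Finset.sum_le_sum fun p _ => h p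
  have h2 : (0 : ℝ) < (N : ℝ) ^ 2 := by positivity
  rw [inv_mul_le_iff₀ h2]
  refine h1.trans (le_of_eq ?_)
  rw [Finset.sum_const, Finset.card_univ, Fintype.card_prod, Fintype.card_fin, nsmul_eq_mul]
  push_cast; ring

lemma fejKer_le_one {N : ℕ} (hN : 0 < N) (c b s : ℝ) : fejKer N c b s ≤ 1 :=
  inv_mul_sum_le hN fun _ => Real.cos_le_one _

lemma fejKer_self {N : ℕ} (hN : 0 < N) (c b : ℝ) : fejKer N c b b = 1 := by
  unfold fejKer
  have : (N : ℝ) ≠ 0 := by positivity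
  simp
  field_simp

lemma contDiff_fejKer (N : ℕ) (c b : ℝ) : ContDiff ℝ ∞ (fejKer N c b) := by
  unfold fejKer
  fun_prop

lemma abs_iteratedDeriv_cos_le (k : ℕ) (w b s : ℝ) :
    |iteratedDeriv k (fun s => Real.cos (w * (s - b))) s| ≤ |w| ^ k := by
  have h := iteratedDeriv_comp_sub_const k (fun s => Real.cos (w * s)) b
  have h' := congrFun h s
  rw [h', iteratedDeriv_comp_const_mul Real.contDiff_cos]
  simp only [abs_mul, abs_pow]
  exact mul_le_of_le_one_right (by positivity) (Real.abs_iteratedDeriv_cos_le_one _ _)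

lemma bernsteinClass_fej {N : ℕ} (hN : 0 < N) {c : ℝ} (hc : 0 ≤ c) (b : ℝ) :
    BernsteinClass c (fun s => 1 - fejKer N c b s) := by
  refine ⟨contDiff_const.sub (contDiff_fejKer N c b), fun k s => ?_⟩
  rcases Nat.eq_zero_or_pos k with rfl | hk
  · have h1 := fejKer_le_one hN c b s
    have h2 := fejKer_nonneg N c b s
    simp only [iteratedDeriv_zero, pow_zero]
    rw [abs_le]; constructor <;> linarith
  · rw [iteratedDeriv_const_sub hk, iteratedDeriv_neg, abs_neg]
    change |iteratedDeriv k (fun s => ((N : ℝ) ^ 2)⁻¹ *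
      ∑ p : Fin N × Fin N, Real.cos (fejFreq N c p * (s - b))) s| ≤ _
    rw [iteratedDeriv_const_mul_field, iteratedDeriv_fun_sum (fun i _ => by fun_prop), abs_mul,
      abs_of_nonneg (by positivity)]
    refine (mul_le_mul_of_nonneg_left (Finset.abs_sum_le_sum_abs _ _) (by positivity)).trans ?_
    refine inv_mul_sum_le hN fun p => ?_
    refine (abs_iteratedDeriv_cos_le _ _ _ _).trans ?_
    exact pow_le_pow_left₀ (abs_nonneg _) (abs_fejFreq_le hc p) k

lemma contDiff_iteratedDeriv {g : ℝ → ℝ} (hg : ContDiff ℝ ∞ g) (m : ℕ) :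
    ContDiff ℝ ∞ (iteratedDeriv m g) := by
  rw [iteratedDeriv_eq_iterate]
  exact hg.iterate_deriv m

lemma partialDeriv_comp_sum {d : ℕ} (i : Fin d) {g : ℝ → ℝ} (hg : ContDiff ℝ ∞ g) :
    partialDeriv i (fun t => g (∑ j, t j)) = fun t => deriv g (∑ j, t j) := by
  funext t
  unfold partialDeriv
  have h1 : HasFDerivAt (fun t : Fin d → ℝ => ∑ j, t j)
      (∑ j, ContinuousLinearMap.proj (R := ℝ) (φ := fun _ : Fin d => ℝ) j) t := by
    have := (∑ j, ContinuousLinearMap.proj (R := ℝ) (φ := fun _ : Fin d => ℝ) j).hasFDerivAt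
      (x := t)
    convert this using 1
    funext t; simp
  have h2 : HasDerivAt g (deriv g (∑ j, t j)) (∑ j, t j) :=
    (hg.differentiable (by simp) _).hasDerivAt
  have h3 := (h2.comp_hasFDerivAt t h1).fderiv
  have h4 : (g ∘ fun t : Fin d → ℝ => ∑ j, t j) = fun t => g (∑ j, t j) := rfl
  rw [h4] at h3
  rw [h3]
  simp

lemma iterate_partialDeriv {d : ℕ} (i : Fin d) (m : ℕ) {g : ℝ → ℝ} (hg : ContDiff ℝ ∞ g) :
    (partialDeriv i)^[m] (fun t => g (∑ j, t j)) = fun t => iteratedDeriv m g (∑ j, t j) := by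
  induction m with
  | zero => simp
  | succ m ih =>
    rw [Function.iterate_succ_apply', ih, partialDeriv_comp_sum, iteratedDeriv_succ]
    exact contDiff_iteratedDeriv hg m

lemma multiDeriv_comp_sum {d : ℕ} (α : Fin d → ℕ) {g : ℝ → ℝ} (hg : ContDiff ℝ ∞ g) :
    ∃ k, multiDeriv α (fun t => g (∑ j, t j)) = fun t => iteratedDeriv k g (∑ j, t j) := by
  unfold multiDeriv
  induction List.finRange d with
  | nil => exact ⟨0, by simp⟩
  | cons i l ih =>
    obtain ⟨k, hk⟩ := ih
    refine ⟨α i + k, ?_⟩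
    rw [List.foldr_cons, hk, iterate_partialDeriv _ _ (contDiff_iteratedDeriv hg k)]
    funext t
    simp [iteratedDeriv_eq_iterate, Function.iterate_add_apply]

lemma one_sub_sum_le_prod {ι : Type*} (I : Finset ι) (u : ι → ℝ) (h0 : ∀ i, 0 ≤ u i)
    (h1 : ∀ i, u i ≤ 1) : 1 - ∑ i ∈ I, u i ≤ ∏ i ∈ I, (1 - u i) := by
  classical
  have hp : ∀ J : Finset ι, ∏ i ∈ J, (1 - u i) ≤ 1 := fun J =>
    Finset.prod_le_one (fun i _ => by linarith [h1 i]) (fun i _ => by linarith [h0 i])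
  induction I using Finset.induction_on with
  | empty => simp
  | insert i I hi ih =>
    rw [Finset.prod_insert hi, Finset.sum_insert hi]
    nlinarith [hp I, h0 i, h1 i]

/-- Characteristic function of the uniform law on the unit interval. -/
noncomputable def chi (w : ℝ) : ℂ := ∫ t in Set.Icc (0 : ℝ) 1, Complex.exp (Complex.I * w * t)

lemma norm_chi_lt {w : ℝ} (hw : w ≠ 0) : ‖chi w‖ < 1 := by
  have hw' : Complex.I * (w : ℂ) ≠ 0 := mul_ne_zero Complex.I_ne_zero (by exact_mod_cast hw)
  unfold chi
  rw [integral_Icc_eq_integral_Ioc, ← intervalIntegral.integral_of_le zero_le_one,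
    integral_exp_mul_complex hw']
  simp only [Complex.ofReal_one, mul_one, Complex.ofReal_zero, mul_zero, Complex.exp_zero]
  rw [norm_div, Complex.norm_exp_I_mul_ofReal_sub_one, norm_mul Complex.I, Complex.norm_I, one_mul,
    Complex.norm_real, div_lt_one (by simpa using hw)]
  have h : |Real.sin (w / 2)| < |w / 2| := Real.abs_sin_lt_abs (by positivity)
  rw [abs_div] at h
  simp only [norm_mul, Real.norm_eq_abs] 
  norm_num at h ⊢
  linarith

lemma norm_chi_zero : ‖chi 0‖ = 1 := by simp [chi]

lemma cube_eq (d : ℕ) : cube d = Set.univ.pi fun _ => Set.Icc (0 : ℝ) 1 := by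
  unfold cube
  rw [← Set.pi_univ_Icc]; rfl

lemma integral_exp_cube (d : ℕ) (w : ℝ) :
    ∫ t in cube d, Complex.exp (Complex.I * w * ((∑ j, t j : ℝ) : ℂ)) = chi w ^ d := by
  rw [cube_eq, volume_pi, Measure.restrict_pi_pi]
  have : ∀ t : Fin d → ℝ, Complex.exp (Complex.I * w * ((∑ j, t j : ℝ) : ℂ)) =
      ∏ j, Complex.exp (Complex.I * w * (t j : ℂ)) := by
    intro t
    rw [← Complex.exp_sum]
    push_cast
    rw [Finset.mul_sum]
  simp_rw [this]
  have h := integral_fintype_prod_eq_pow (ι := Fin d)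
    (μ := (volume : Measure ℝ).restrict (Set.Icc (0 : ℝ) 1))
    (fun t : ℝ => Complex.exp (Complex.I * w * (t : ℂ)))
  rw [Fintype.card_fin] at h
  exact h

lemma isCompact_cube (d : ℕ) : IsCompact (cube d) := isCompact_Icc

lemma integral_cos_cube_le (d : ℕ) (w b : ℝ) :
    ∫ t in cube d, Real.cos (w * (∑ j, t j - b)) ≤ ‖chi w‖ ^ d := by
  have e : ∀ t : Fin d → ℝ, Real.cos (w * (∑ j, t j - b)) =
      RCLike.re (Complex.exp (-(Complex.I * w * b)) *
        Complex.exp (Complex.I * w * ((∑ j, t j : ℝ) : ℂ))) := by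
    intro t
    rw [← Complex.exp_add, ← Complex.exp_ofReal_mul_I_re]
    simp only [RCLike.re_to_complex]
    congr 2
    push_cast
    ring
  simp_rw [e]
  rw [integral_re, integral_const_mul, integral_exp_cube]
  · refine (RCLike.re_le_norm _).trans ?_
    rw [norm_mul, norm_pow]
    have : ‖Complex.exp (-(Complex.I * w * b))‖ = 1 := by
      rw [Complex.norm_exp]; simp
    rw [this, one_mul]
  · exact ContinuousOn.integrableOn_compact (isCompact_cube d) (by fun_prop)

lemma volume_cube (d : ℕ) : (volume : Measure (Fin d → ℝ)).real (cube d) = 1 := by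
  rw [cube_eq, measureReal_def, volume_pi_pi]; simp

lemma integral_fejKer_le (N d : ℕ) (c b : ℝ) :
    ∫ t in cube d, fejKer N c b (∑ j, t j) ≤
      ((N : ℝ) ^ 2)⁻¹ * ∑ p : Fin N × Fin N, ‖chi (fejFreq N c p)‖ ^ d := by
  unfold fejKer
  rw [integral_const_mul, integral_finsetSum]
  · refine mul_le_mul_of_nonneg_left (Finset.sum_le_sum fun p _ => ?_) (by positivity)
    exact integral_cos_cube_le _ _ _
  · intro p _
    exact ContinuousOn.integrableOn_compact (isCompact_cube d) (by fun_prop)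

lemma tendsto_bound {N : ℕ} (hN : 0 < N) {c : ℝ} (hc : 0 < c) :
    Filter.Tendsto (fun d : ℕ => ((N : ℝ) ^ 2)⁻¹ * ∑ p : Fin N × Fin N, ‖chi (fejFreq N c p)‖ ^ d)
      Filter.atTop (nhds (1 / N)) := by
  have h : Filter.Tendsto (fun d : ℕ => ((N : ℝ) ^ 2)⁻¹ *
      ∑ p : Fin N × Fin N, ‖chi (fejFreq N c p)‖ ^ d) Filter.atTop
      (nhds (((N : ℝ) ^ 2)⁻¹ * ∑ p : Fin N × Fin N, if p.1 = p.2 then (1 : ℝ) else 0)) := by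
    refine Filter.Tendsto.const_mul _ (tendsto_finsetSum _ fun p _ => ?_)
    have hN' : (N : ℝ) ≠ 0 := by positivity
    split_ifs with hp
    · have : fejFreq N c p = 0 := by simp [fejFreq, hp]
      rw [this, norm_chi_zero]
      exact tendsto_const_nhds.congr fun d => (one_pow d).symm
    · refine tendsto_pow_atTop_nhds_zero_of_lt_one (norm_nonneg _) (norm_chi_lt ?_)
      unfold fejFreq
      refine mul_ne_zero (div_ne_zero (sub_ne_zero.2 ?_) hN') hc.ne'
      intro h
      exact hp (Fin.ext (by exact_mod_cast h))
  convert h using 2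
  have hN' : (N : ℝ) ≠ 0 := by positivity
  rw [Fintype.sum_prod_type]
  simp
  field_simp

/-- For every positive integer `n` and every `η ∈ (0,1)` there exists `D` such that for all
`d ≥ D`: for every choice of coefficients `a_1, …, a_n` and sample points
`x_1, …, x_n ∈ [0,1]^d`, there is an infinitely differentiable `f` with `|D^α f| ≤ 1` on the
cube for every multiindex `α`, vanishing at all the sample points, whose integral over the
cube exceeds `1 - η`; in particular `|I_d(f) - ∑ j, a_j f(x_j)| > 1 - η`. -/
theorem exists_fooling_function (n : ℕ) (hn : 0 < n) (η : ℝ) (hη : η ∈ Set.Ioo (0 : ℝ) 1) :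
    ∃ D : ℕ, 0 < D ∧ ∀ d : ℕ, D ≤ d →
      ∀ (a : Fin n → ℝ) (x : Fin n → Fin d → ℝ), (∀ j, x j ∈ cube d) →
        ∃ f : (Fin d → ℝ) → ℝ,
          ContDiff ℝ (⊤ : ℕ∞) f ∧
          (∀ (α : Fin d → ℕ), ∀ t ∈ cube d, |multiDeriv α f t| ≤ 1) ∧
          (∀ j, f (x j) = 0) ∧
          (1 - η < ∫ t in cube d, f t) ∧
          1 - η < |(∫ t in cube d, f t) - ∑ j, a j * f (x j)| := by
  obtain ⟨hη0, hη1⟩ := hη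
  have hn' : (0 : ℝ) < n := by exact_mod_cast hn
  obtain ⟨N, hN⟩ := exists_nat_gt ((n : ℝ) / η)
  have hN0' : (0 : ℝ) < N := lt_trans (by positivity) hN
  have hN0 : 0 < N := by exact_mod_cast hN0'
  have hlt : (1 : ℝ) / N < η / n := by
    rw [div_lt_iff₀ hη0] at hN
    rw [div_lt_div_iff₀ hN0' hn']
    linarith
  have hc : (0 : ℝ) < 1 / n := by positivity
  obtain ⟨D, hD⟩ := Filter.eventually_atTop.1 ((tendsto_bound hN0 hc).eventually_lt_const hlt)
  refine ⟨D + 1, by omega, fun d hd a x _ => ?_⟩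
  have hB := hD d (by omega)
  set g : ℝ → ℝ := ∏ j : Fin n, fun s => 1 - fejKer N (1 / n) (∑ i, x j i) s with hgdef
  have hg : BernsteinClass 1 g := by
    have := BernsteinClass.prod (Finset.univ : Finset (Fin n))
      (fun j => bernsteinClass_fej hN0 hc.le (∑ i, x j i))
    convert this using 1
    rw [Finset.card_univ, Fintype.card_fin]
    field_simp
  have hfx : ∀ j, g (∑ i, x j i) = 0 := by
    intro j
    rw [hgdef, Finset.prod_apply]
    refine Finset.prod_eq_zero (Finset.mem_univ j) ?_
    rw [fejKer_self hN0, sub_self]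
  have hker : ∀ j : Fin n, IntegrableOn
      (fun t : Fin d → ℝ => fejKer N (1 / n) (∑ i, x j i) (∑ i, t i)) (cube d) := by
    intro j
    refine ContinuousOn.integrableOn_compact (isCompact_cube d) (Continuous.continuousOn ?_)
    exact (contDiff_fejKer N (1 / n) (∑ i, x j i)).continuous.comp (by fun_prop)
  have hone : IntegrableOn (fun _ : Fin d → ℝ => (1 : ℝ)) (cube d) :=
    ContinuousOn.integrableOn_compact (isCompact_cube d) (by fun_prop)
  have hsum : IntegrableOn (fun t : Fin d → ℝ =>
      ∑ j : Fin n, fejKer N (1 / n) (∑ i, x j i) (∑ i, t i)) (cube d) :=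
    integrable_finsetSum _ fun j _ => hker j
  have hint : 1 - η < ∫ t in cube d, g (∑ i, t i) := by
    have h1 : ∫ t in cube d, (1 - ∑ j : Fin n, fejKer N (1 / n) (∑ i, x j i) (∑ i, t i)) ≤
        ∫ t in cube d, g (∑ i, t i) := by
      refine integral_mono (hone.sub hsum) ?_ fun t => ?_
      · refine ContinuousOn.integrableOn_compact (isCompact_cube d) (Continuous.continuousOn ?_)
        exact hg.1.continuous.comp (by fun_prop)
      · simp only [hgdef, Finset.prod_apply]
        exact one_sub_sum_le_prod _ _ (fun j => fejKer_nonneg _ _ _ _)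
          (fun j => fejKer_le_one hN0 _ _ _)
    rw [integral_sub hone hsum, integral_finsetSum _ fun j _ => hker j, setIntegral_const,
      volume_cube] at h1
    have h2 : ∑ j : Fin n, ∫ t in cube d, fejKer N (1 / n) (∑ i, x j i) (∑ i, t i) <
        ∑ _j : Fin n, η / n := by
      have : Nonempty (Fin n) := ⟨⟨0, hn⟩⟩
      exact Finset.sum_lt_sum_of_nonempty Finset.univ_nonempty fun j _ =>
        (integral_fejKer_le N d (1 / n) _).trans_lt hB
    have h3 : ∑ _j : Fin n, η / n = η := by
      simp
      field_simp
    simp only [smul_eq_mul, mul_one] at h1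
    linarith
  refine ⟨fun t => g (∑ i, t i), ?_, ?_, hfx, hint, ?_⟩
  · exact hg.1.comp (by fun_prop)
  · intro α t _
    obtain ⟨k, hk⟩ := multiDeriv_comp_sum α hg.1
    rw [hk]
    simpa using hg.2 k (∑ i, t i)
  · have : ∑ j, a j * g (∑ i, x j i) = 0 := Finset.sum_eq_zero fun j _ => by rw [hfx, mul_zero]
    simp only [this, sub_zero]
    exact hint.trans_le (le_abs_self _)
end

section
/- For every positive integer n and every η ∈ (0,1) there exists a constant K_{η,n} such that for every choice of points y_1, y_2, …, y_n ∈ [0,1] there exists a polynomial f : [0,1] → ℝ satisfying: (1) max_{x∈[0,1]} |f(x)| ≤ 1; (2) |f^{(k)}(x)| ≤ K_{η,n} for every k = 0,1,2,… and every x ∈ [0,1]; (3) ∫_0^1 f(x) dx > 1 − η; (4) f(y_j) = 0 for j = 1, 2, …, n. -/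
open Polynomial

/-- `P` dominates `p` coefficientwise. -/
def CoeffDom (p P : Polynomial ℝ) : Prop := ∀ k, |p.coeff k| ≤ P.coeff k

theorem CoeffDom.mul {p P q Q : Polynomial ℝ} (hp : CoeffDom p P) (hq : CoeffDom q Q) :
    CoeffDom (p * q) (P * Q) := by
  intro k
  rw [coeff_mul, coeff_mul]
  refine (Finset.abs_sum_le_sum_abs _ _).trans (Finset.sum_le_sum fun i _ => ?_)
  rw [abs_mul]
  exact mul_le_mul (hp _) (hq _) (abs_nonneg _) ((abs_nonneg _).trans (hp _))

theorem CoeffDom.sub {p P q Q : Polynomial ℝ} (hp : CoeffDom p P) (hq : CoeffDom q Q) :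
    CoeffDom (p - q) (P + Q) := by
  intro k
  rw [coeff_sub, coeff_add]
  exact (abs_sub _ _).trans (add_le_add (hp k) (hq k))

theorem CoeffDom.one : CoeffDom 1 1 := by
  intro k
  rw [coeff_one]
  split_ifs <;> simp

theorem CoeffDom.pow {p P : Polynomial ℝ} (hp : CoeffDom p P) (m : ℕ) :
    CoeffDom (p ^ m) (P ^ m) := by
  induction m with
  | zero => simpa using CoeffDom.one
  | succ m ih => rw [pow_succ, pow_succ]; exact ih.mul hp

theorem CoeffDom.prod {ι : Type*} (s : Finset ι) (p : ι → Polynomial ℝ) (P : Polynomial ℝ)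
    (h : ∀ i ∈ s, CoeffDom (p i) P) : CoeffDom (∏ i ∈ s, p i) (P ^ s.card) := by
  classical
  induction s using Finset.induction_on with
  | empty => simpa using CoeffDom.one
  | insert a s ha ih =>
    rw [Finset.prod_insert ha, Finset.card_insert_of_notMem ha, pow_succ']
    exact (h a (by simp)).mul (ih fun i hi => h i (by simp [hi]))

theorem CoeffDom.derivative {p P : Polynomial ℝ} (hp : CoeffDom p P) :
    CoeffDom (derivative p) (derivative P) := by
  intro k
  rw [coeff_derivative, coeff_derivative, abs_mul, abs_of_nonneg (by positivity : (0:ℝ) ≤ (k:ℝ) + 1)]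
  exact mul_le_mul_of_nonneg_right (hp _) (by positivity)

theorem CoeffDom.iter {p P : Polynomial ℝ} (hp : CoeffDom p P) (k : ℕ) :
    CoeffDom (Polynomial.derivative^[k] p) (Polynomial.derivative^[k] P) := by
  induction k with
  | zero => exact hp
  | succ k ih =>
    rw [Function.iterate_succ_apply', Function.iterate_succ_apply']
    exact ih.derivative

theorem CoeffDom.eval {p P : Polynomial ℝ} (hp : CoeffDom p P) {x : ℝ}
    (hx : x ∈ Set.Icc (0:ℝ) 1) : |p.eval x| ≤ P.eval 1 := by
  have h1 : p.natDegree < max p.natDegree P.natDegree + 1 := by omega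
  have h2 : P.natDegree < max p.natDegree P.natDegree + 1 := by omega
  rw [eval_eq_sum_range' h1, eval_eq_sum_range' h2]
  refine (Finset.abs_sum_le_sum_abs _ _).trans (Finset.sum_le_sum fun i _ => ?_)
  rw [abs_mul, one_pow, mul_one, abs_of_nonneg (pow_nonneg hx.1 i)]
  exact (mul_le_of_le_one_right (abs_nonneg _) (pow_le_one₀ hx.1 hx.2)).trans (hp i)

theorem CoeffDom.bound (P : Polynomial ℝ) : ∃ K : ℝ, ∀ p, CoeffDom p P →
    ∀ k : ℕ, ∀ x ∈ Set.Icc (0 : ℝ) 1, |((Polynomial.derivative^[k] p)).eval x| ≤ K := by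
  refine ⟨∑ k ∈ Finset.range (P.natDegree + 1), |(Polynomial.derivative^[k] P).eval 1|, ?_⟩
  intro p hp k x hx
  refine ((hp.iter k).eval hx).trans ?_
  by_cases hk : k < P.natDegree + 1
  · exact (le_abs_self _).trans (Finset.single_le_sum
      (f := fun k => |(Polynomial.derivative^[k] P).eval 1|)
      (fun i _ => abs_nonneg _) (Finset.mem_range.2 hk))
  · rw [iterate_derivative_eq_zero (by omega), eval_zero]
    exact Finset.sum_nonneg fun i _ => abs_nonneg _

theorem CoeffDom.lin {y : ℝ} (hy : y ∈ Set.Icc (0:ℝ) 1) : CoeffDom (X - C y) (X + 1) := by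
  have hX : CoeffDom X X := by
    intro k
    rw [coeff_X]
    split_ifs <;> simp
  refine hX.sub ?_
  intro k
  rw [coeff_C, coeff_one]
  by_cases h : k = 0
  · simp [h, abs_of_nonneg hy.1, hy.2]
  · simp [h, Ne.symm h]

theorem one_sub_sum_le_prod_aux {ι : Type*} (s : Finset ι) (a : ι → ℝ)
    (h0 : ∀ i, 0 ≤ a i) (h1 : ∀ i, a i ≤ 1) :
    1 - ∑ i ∈ s, a i ≤ ∏ i ∈ s, (1 - a i) := by
  classical
  induction s using Finset.induction_on with
  | empty => simp
  | insert b s hb ih =>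
    rw [Finset.prod_insert hb, Finset.sum_insert hb]
    have : ∏ i ∈ s, (1 - a i) ≤ 1 :=
      Finset.prod_le_one (fun i _ => by linarith [h1 i]) (fun i _ => by linarith [h0 i])
    nlinarith [h0 b, h1 b]

theorem gauss_aux (N : ℕ) (hN : 0 < N) (y : ℝ) :
    ∫ x in (0:ℝ)..1, Real.exp (-(N:ℝ) * (x - y) ^ 2) ≤ Real.sqrt (Real.pi / N) := by
  have hi : MeasureTheory.Integrable fun x : ℝ => Real.exp (-(N:ℝ) * (x - y) ^ 2) :=
    (integrable_exp_neg_mul_sq (by exact_mod_cast hN : (0:ℝ) < N)).comp_sub_right y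
  rw [intervalIntegral.integral_of_le zero_le_one, ← integral_gaussian,
    ← MeasureTheory.integral_sub_right_eq_self (fun x : ℝ => Real.exp (-(N:ℝ) * x ^ 2)) y]
  exact MeasureTheory.setIntegral_le_integral hi
    (Filter.Eventually.of_forall fun x => (Real.exp_pos _).le)

/-- Key lemma: for every positive integer `n` and `η ∈ (0,1)` there is a constant `K`
(depending only on `η` and `n`) such that for every choice of points `y_1, …, y_n ∈ [0,1]`
there is a polynomial `f` with `|f| ≤ 1` on `[0,1]`, all derivatives bounded by `K` on
`[0,1]`, integral over `[0,1]` exceeding `1 - η`, and vanishing at all the `y_j`. -/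
theorem exists_derivative_bound_fooling_polynomial
    (n : ℕ) (hn : 0 < n) (η : ℝ) (hη : η ∈ Set.Ioo (0 : ℝ) 1) :
    ∃ K : ℝ, ∀ y : Fin n → ℝ, (∀ j, y j ∈ Set.Icc (0 : ℝ) 1) →
      ∃ f : Polynomial ℝ,
        (∀ x ∈ Set.Icc (0 : ℝ) 1, |f.eval x| ≤ 1) ∧
        (∀ k : ℕ, ∀ x ∈ Set.Icc (0 : ℝ) 1, |((derivative^[k] f)).eval x| ≤ K) ∧
        (1 - η < ∫ x in (0:ℝ)..1, f.eval x) ∧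
        (∀ j, f.eval (y j) = 0) := by
  have hη0 : 0 < η := hη.1
  have hn' : (0:ℝ) < n := by exact_mod_cast hn
  obtain ⟨N, hN⟩ := exists_nat_gt (Real.pi / (η / n) ^ 2)
  have hN0' : (0:ℝ) < N := lt_of_le_of_lt (by positivity) hN
  have hN0 : 0 < N := by exact_mod_cast hN0'
  have hs : n * Real.sqrt (Real.pi / N) < η := by
    rw [mul_comm, ← lt_div_iff₀ hn', Real.sqrt_lt' (by positivity), div_lt_iff₀ hN0']
    rwa [div_lt_iff₀ (by positivity), mul_comm] at hN
  obtain ⟨K, hK⟩ := CoeffDom.bound ((1 + (1 + (X + 1) ^ 2) ^ N) ^ n)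
  refine ⟨K, fun y hy => ?_⟩
  have hev : ∀ x, (∏ j, (1 - (1 - (X - C (y j)) ^ 2) ^ N) : ℝ[X]).eval x
      = ∏ j, (1 - (1 - (x - y j) ^ 2) ^ N) := by
    intro x
    simp [eval_prod]
  have hsq : ∀ x ∈ Set.Icc (0:ℝ) 1, ∀ j, 0 ≤ 1 - (x - y j) ^ 2 := by
    intro x hx j
    have := hy j
    nlinarith [hx.1, hx.2, this.1, this.2]
  have ha0 : ∀ x ∈ Set.Icc (0:ℝ) 1, ∀ j, 0 ≤ (1 - (x - y j) ^ 2) ^ N :=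
    fun x hx j => pow_nonneg (hsq x hx j) _
  have ha1 : ∀ x ∈ Set.Icc (0:ℝ) 1, ∀ j, (1 - (x - y j) ^ 2) ^ N ≤ 1 :=
    fun x hx j => pow_le_one₀ (hsq x hx j) (by nlinarith [sq_nonneg (x - y j)])
  have hae : ∀ x ∈ Set.Icc (0:ℝ) 1, ∀ j,
      (1 - (x - y j) ^ 2) ^ N ≤ Real.exp (-(N:ℝ) * (x - y j) ^ 2) := by
    intro x hx j
    have h : 1 - (x - y j) ^ 2 ≤ Real.exp (-(x - y j) ^ 2) := by
      have := Real.add_one_le_exp (-(x - y j) ^ 2)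
      linarith
    refine (pow_le_pow_left₀ (hsq x hx j) h N).trans (le_of_eq ?_)
    rw [← Real.exp_nat_mul]
    congr 1
    ring
  refine ⟨∏ j, (1 - (1 - (X - C (y j)) ^ 2) ^ N), ?_, ?_, ?_, ?_⟩
  · intro x hx
    rw [hev, abs_of_nonneg]
    · exact Finset.prod_le_one (fun i _ => by linarith [ha1 x hx i])
        (fun i _ => by linarith [ha0 x hx i])
    · exact Finset.prod_nonneg (fun i _ => by linarith [ha1 x hx i])
  · refine hK _ ?_
    have := CoeffDom.prod (Finset.univ : Finset (Fin n))
      (fun j => (1 - (1 - (X - C (y j)) ^ 2) ^ N)) (1 + (1 + (X + 1) ^ 2) ^ N)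
      (fun j _ => CoeffDom.one.sub ((CoeffDom.one.sub ((CoeffDom.lin (hy j)).pow 2)).pow N))
    simpa using this
  · have hc : ∀ j, IntervalIntegrable (fun x : ℝ => Real.exp (-(N:ℝ) * (x - y j) ^ 2))
        MeasureTheory.volume 0 1 := fun j => Continuous.intervalIntegrable (by fun_prop) _ _
    have h1 : ∫ x in (0:ℝ)..1, (1 - ∑ j, Real.exp (-(N:ℝ) * (x - y j) ^ 2)) ≤
        ∫ x in (0:ℝ)..1, (∏ j, (1 - (1 - (X - C (y j)) ^ 2) ^ N) : ℝ[X]).eval x := by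
      refine intervalIntegral.integral_mono_on zero_le_one
        (Continuous.intervalIntegrable (by fun_prop) _ _)
        (Continuous.intervalIntegrable (Polynomial.continuous _) _ _) ?_
      intro x hx
      rw [hev]
      refine le_trans ?_ (one_sub_sum_le_prod_aux _ _ (ha0 x hx) (ha1 x hx))
      exact sub_le_sub_left (Finset.sum_le_sum fun j _ => hae x hx j) _
    rw [intervalIntegral.integral_sub (by simp)
      (Continuous.intervalIntegrable (by fun_prop) _ _),
      intervalIntegral.integral_finsetSum (fun j _ => hc j)] at h1
    have h2 : ∑ j, ∫ x in (0:ℝ)..1, Real.exp (-(N:ℝ) * (x - y j) ^ 2)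
        ≤ n * Real.sqrt (Real.pi / N) := by
      refine (Finset.sum_le_sum fun j _ => gauss_aux N hN0 (y j)).trans (le_of_eq ?_)
      simp
    have h3 : ∫ x in (0:ℝ)..1, (1:ℝ) = 1 := by simp
    linarith
  · intro j
    rw [hev]
    exact Finset.prod_eq_zero (Finset.mem_univ j) (by simp)
end

section
/- For every δ ∈ (0, 1/3) there exist a polynomial P : ℝ → ℝ and a point y_0 ∈ (1, 1+δ) such that P(y_0) = 0, |P(x)| < 1 for all x ∈ [0, 2+δ], and 1 − 2δ < P(x) < 1 for all x ∈ [0, 2+δ] with x ∉ (1−δ, 1+δ). -/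
open Polynomial

/-- For every `δ ∈ (0, 1/3)` there exist a polynomial `P` and a point `y₀ ∈ (1, 1+δ)` with
`P(y₀) = 0`, `|P(x)| < 1` on `[0, 2+δ]`, and `1 - 2δ < P(x) < 1` on `[0, 2+δ]` outside the
interval `(1-δ, 1+δ)`. -/
theorem exists_weierstrass_polynomial (δ : ℝ) (hδ : δ ∈ Set.Ioo (0 : ℝ) (1/3)) :
    ∃ (P : Polynomial ℝ) (y₀ : ℝ), y₀ ∈ Set.Ioo (1 : ℝ) (1 + δ) ∧
      P.eval y₀ = 0 ∧
      (∀ x ∈ Set.Icc (0 : ℝ) (2 + δ), |P.eval x| < 1) ∧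
      (∀ x ∈ Set.Icc (0 : ℝ) (2 + δ), x ∉ Set.Ioo (1 - δ) (1 + δ) →
        1 - 2 * δ < P.eval x ∧ P.eval x < 1) := by
  obtain ⟨h0, h1⟩ := hδ
  obtain ⟨P, hP⟩ := exists_polynomial_near_of_continuousOn 0 (2 + δ)
    (fun x => min (1 - δ) (-2 * δ + (1 + δ) / δ * |x - 1|))
    (by fun_prop) δ h0
  have hc : 0 < (1 + δ) / δ := by positivity
  have hout : ∀ x ∈ Set.Icc (0 : ℝ) (2 + δ), x ∉ Set.Ioo (1 - δ) (1 + δ) →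
      1 - 2 * δ < P.eval x ∧ P.eval x < 1 := by
    intro x hx hn
    have hd : δ ≤ |x - 1| := by
      by_contra! h
      rw [abs_lt] at h
      exact hn ⟨by linarith, by linarith⟩
    have h2 : (1 + δ) / δ * δ = 1 + δ := by field_simp
    have h3 := mul_le_mul_of_nonneg_left hd hc.le
    have h4 := hP x hx
    rw [min_eq_left (by linarith), abs_lt] at h4
    constructor <;> linarith [h4.1, h4.2]
  have hone : P.eval 1 < 0 := by
    have h4 := hP 1 ⟨by linarith, by linarith⟩
    simp only [sub_self, abs_zero, mul_zero, add_zero] at h4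
    rw [min_eq_right (by linarith), abs_lt] at h4
    linarith [h4.2]
  have hend : 0 < P.eval (1 + δ) := by
    have := (hout (1 + δ) ⟨by linarith, by linarith⟩ (fun h => lt_irrefl _ h.2)).1
    linarith
  obtain ⟨y, hy, hy0⟩ := intermediate_value_Ioo (by linarith : (1 : ℝ) ≤ 1 + δ)
    P.continuous.continuousOn ⟨hone, hend⟩
  refine ⟨P, y, hy, hy0, ?_, hout⟩
  intro x hx
  have h4 := hP x hx
  have h5 := min_le_left (1 - δ) (-2 * δ + (1 + δ) / δ * |x - 1|)
  have h6 : -2 * δ ≤ min (1 - δ) (-2 * δ + (1 + δ) / δ * |x - 1|) :=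
    le_min (by linarith) (by have := mul_nonneg hc.le (abs_nonneg (x - 1)); linarith)
  rw [abs_lt] at h4 ⊢
  constructor <;> linarith [h4.1, h4.2]
end

section
/- Let n be a positive integer, δ ∈ (0, 1/3), and let P : ℝ → ℝ be a polynomial and y_0 ∈ (1, 1+δ) satisfy P(y_0) = 0, |P(x)| < 1 for all x ∈ [0, 2+δ], and P(x) > 1 − 2δ for all x ∈ [0, 2+δ] with x ∉ (1−δ, 1+δ). For points y_1, …, y_n ∈ [0,1], define the polynomial f(x) = Π_{i=1}^n P(x + y_0 − y_i)^2. Then: (1) f(y_j) = 0 for every j = 1, …, n; (2) 0 ≤ f(x) < 1 for all x ∈ [0,1]; (3) f(x) > (1 − 2δ)^{2n} for every x ∈ [0,1] outside the union ∪_{i=1}^n [y_i − 2δ, y_i + δ]. -/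
open Polynomial

/-- Properties of the fooling polynomial `f(x) = ∏_{i=1}^n P(x + y₀ - y_i)²` built from a
polynomial `P` and root `y₀ ∈ (1, 1+δ)` as in the Weierstrass-approximation step:
`f` vanishes at each `y_j`, satisfies `0 ≤ f < 1` on `[0,1]`, and exceeds `(1-2δ)^{2n}`
on `[0,1]` outside `∪_i [y_i - 2δ, y_i + δ]`. -/
theorem fooling_polynomial_properties
    (n : ℕ) (hn : 0 < n) (δ : ℝ) (hδ : δ ∈ Set.Ioo (0 : ℝ) (1/3))
    (P : Polynomial ℝ) (y₀ : ℝ) (hy₀ : y₀ ∈ Set.Ioo (1 : ℝ) (1 + δ))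
    (hroot : P.eval y₀ = 0)
    (hbound : ∀ x ∈ Set.Icc (0 : ℝ) (2 + δ), |P.eval x| < 1)
    (hlow : ∀ x ∈ Set.Icc (0 : ℝ) (2 + δ), x ∉ Set.Ioo (1 - δ) (1 + δ) →
      1 - 2 * δ < P.eval x)
    (y : Fin n → ℝ) (hy : ∀ j, y j ∈ Set.Icc (0 : ℝ) 1)
    (f : ℝ → ℝ) (hf : ∀ x, f x = ∏ i, (P.eval (x + y₀ - y i)) ^ 2) :
    (∀ j, f (y j) = 0) ∧
    (∀ x ∈ Set.Icc (0 : ℝ) 1, 0 ≤ f x ∧ f x < 1) ∧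
    (∀ x ∈ Set.Icc (0 : ℝ) 1, x ∉ ⋃ i, Set.Icc (y i - 2 * δ) (y i + δ) →
      (1 - 2 * δ) ^ (2 * n) < f x) := by
  obtain ⟨hδ0, hδ1⟩ := hδ
  obtain ⟨h01, h02⟩ := hy₀
  have hmem : ∀ x ∈ Set.Icc (0 : ℝ) 1, ∀ i, x + y₀ - y i ∈ Set.Icc (0 : ℝ) (2 + δ) := by
    intro x hx i
    have h1 := (hy i).1
    have h2 := (hy i).2
    have h3 := hx.1
    have h4 := hx.2
    constructor <;> linarith
  refine ⟨?_, ?_, ?_⟩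
  · intro j
    rw [hf]
    apply Finset.prod_eq_zero (Finset.mem_univ j)
    have : y j + y₀ - y j = y₀ := by ring
    rw [this, hroot]
    norm_num
  · intro x hx
    rw [hf]
    have hlt : ∀ i, (P.eval (x + y₀ - y i)) ^ 2 < 1 := fun i =>
      (sq_lt_one_iff_abs_lt_one _).2 (hbound _ (hmem x hx i))
    refine ⟨Finset.prod_nonneg fun i _ => sq_nonneg _, ?_⟩
    rw [← Finset.mul_prod_erase _ _ (Finset.mem_univ (⟨0, hn⟩ : Fin n))]
    refine mul_lt_one_of_nonneg_of_lt_one_left (sq_nonneg _) (hlt _) ?_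
    exact Finset.prod_le_one (fun i _ => sq_nonneg _) (fun i _ => (hlt i).le)
  · intro x hx hxn
    rw [hf, pow_mul]
    have hpos : 0 < 1 - 2 * δ := by linarith
    have hlt : ∀ i, (1 - 2 * δ) ^ 2 < (P.eval (x + y₀ - y i)) ^ 2 := by
      intro i
      have h := hlow _ (hmem x hx i) (by
        rintro ⟨h1, h2⟩
        exact hxn (Set.mem_iUnion.2 ⟨i, by constructor <;> linarith⟩))
      exact pow_lt_pow_left₀ h hpos.le (by norm_num)
    calc ((1 - 2 * δ) ^ 2) ^ n = ∏ _i : Fin n, (1 - 2 * δ) ^ 2 := by simp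
      _ < _ := Finset.prod_lt_prod (fun i _ => by positivity) (fun i _ => (hlt i).le)
        ⟨⟨0, hn⟩, Finset.mem_univ _, hlt _⟩
end
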